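/- Let J(p) = ∫_{−∞}^{∞} e^{2ps} Ai(s)² ds for p > 0. Then lim_{p → 0⁺} p^{1/2} J(p) = 1/(2^{3/2}√π). -/

import Mathlib

open Set Filter Topology MeasureTheory

lemma airy_unique {a b t₀ : ℝ} (ht : t₀ ∈ Ioo a b) (f f1 g g1 : ℝ → ℝ)
    (hf : ∀ t ∈ Ioo a b, HasDerivAt f (f1 t) t) (hf1 : ∀ t ∈ Ioo a b, HasDerivAt f1 (t * f t) t)
    (hg : ∀ t ∈ Ioo a b, HasDerivAt g (g1 t) t) (hg1 : ∀ t ∈ Ioo a b, HasDerivAt g1 (t * g t) t)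
    (h0 : f t₀ = g t₀) (h1 : f1 t₀ = g1 t₀) : ∀ t ∈ Ioo a b, f t = g t ∧ f1 t = g1 t := by
  have key := ODE_solution_unique_of_mem_Ioo (E := ℝ × ℝ) (K := Real.toNNReal (1 + |a| + |b|))
    (v := fun t x => (x.2, t * x.1)) (s := fun _ => univ) (a := a) (b := b) (t₀ := t₀)
    (f := fun t => (f t, f1 t)) (g := fun t => (g t, g1 t)) ?_ ht ?_ ?_ ?_
  · intro t ht
    have := key ht
    simpa using this
  · intro t ht
    apply LipschitzWith.lipschitzOnWith
    apply LipschitzWith.of_dist_le_mul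
    intro x y
    have h0 : 0 ≤ 1 + |a| + |b| := by positivity
    have ht' : |t| ≤ |a| + |b| := by
      rw [abs_le]; constructor
      · linarith [neg_abs_le a, abs_nonneg b, ht.1]
      · linarith [le_abs_self b, abs_nonneg a, ht.2]
    rw [Real.coe_toNNReal _ h0, Prod.dist_eq, Prod.dist_eq]
    simp only [Real.dist_eq]
    apply max_le
    · have : |x.2 - y.2| ≤ max |x.1 - y.1| |x.2 - y.2| := le_max_right _ _
      have h3 : 0 ≤ max |x.1 - y.1| |x.2 - y.2| := le_max_of_le_left (abs_nonneg _)
      nlinarith [abs_nonneg a, abs_nonneg b, mul_nonneg (abs_nonneg a) h3, mul_nonneg (abs_nonneg b) h3]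
    · rw [← mul_sub, abs_mul]
      apply mul_le_mul (by linarith) (le_max_left _ _) (abs_nonneg _) h0
  · intro t ht
    exact ⟨(hf t ht).prodMk (hf1 t ht), mem_univ _⟩
  · intro t ht
    exact ⟨(hg t ht).prodMk (hg1 t ht), mem_univ _⟩
  · simp [h0, h1]

lemma airy_right {A : ℝ → ℝ} (hA : ∀ t, HasDerivAt (deriv A) (t * A t) t) {t : ℝ} (ht : t ≠ 0)
    (h : ∀ᶠ x in 𝓝[>] t, deriv A x ≠ 0) : Tendsto A (𝓝[>] t) (𝓝 (A t)) := by
  have hc : Continuous (deriv A) := continuous_iff_continuousAt.2 fun x => (hA x).continuousAt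
  have hb : ∀ᶠ x in 𝓝[>] t, |deriv A x| ≤ |deriv A t| + 1 := by
    apply Filter.Eventually.filter_mono nhdsWithin_le_nhds
    have : ∀ᶠ x in 𝓝 t, |deriv A x| < |deriv A t| + 1 :=
      hc.abs.continuousAt.eventually_lt_const (by simp)
    exact this.mono fun x hx => hx.le
  obtain ⟨u, hu, hs⟩ := mem_nhdsGT_iff_exists_Ioo_subset.1 (h.and hb)
  have hL : LipschitzOnWith (Real.toNNReal (|deriv A t| + 1)) A (Ioo t u) := by
    apply Convex.lipschitzOnWith_of_nnnorm_deriv_le (𝕜 := ℝ)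
    · intro x hx
      exact differentiableAt_of_deriv_ne_zero (hs hx).1
    · intro x hx
      rw [← NNReal.coe_le_coe, coe_nnnorm, Real.norm_eq_abs, Real.coe_toNNReal _ (by positivity)]
      exact (hs hx).2
    · exact convex_Ioo _ _
  obtain ⟨F, hF, hFe⟩ := hL.extend_real
  have hmem : Ioo t u ∈ 𝓝[>] t := Ioo_mem_nhdsGT hu
  have hlim : Tendsto A (𝓝[>] t) (𝓝 (F t)) := by
    have : Tendsto F (𝓝[>] t) (𝓝 (F t)) := hF.continuous.continuousAt.tendsto.mono_left nhdsWithin_le_nhds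
    exact this.congr' (by filter_upwards [hmem] with x hx using (hFe hx).symm)
  have hd := hasDerivWithinAt_Ici_of_tendsto_deriv (f := deriv A) (a := t) (e := t * F t) (s := Ioo t u)
    (fun x _ => (hA x).differentiableAt.differentiableWithinAt) hc.continuousWithinAt hmem ?_
  · have h2 := (hA t).hasDerivWithinAt (s := Ici t)
    have := (uniqueDiffOn_Ici t t self_mem_Ici).eq_deriv (s := Ici t) (f := deriv A) hd h2
    have := mul_left_cancel₀ ht this
    rwa [this] at hlim
  · have : deriv (deriv A) = fun x => x * A x := funext fun x => (hA x).deriv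
    rw [this]
    exact (tendsto_id.mono_left nhdsWithin_le_nhds).mul hlim

lemma airy_left {A : ℝ → ℝ} (hA : ∀ t, HasDerivAt (deriv A) (t * A t) t) {t : ℝ} (ht : t ≠ 0)
    (h : ∀ᶠ x in 𝓝[<] t, deriv A x ≠ 0) : Tendsto A (𝓝[<] t) (𝓝 (A t)) := by
  have hc : Continuous (deriv A) := continuous_iff_continuousAt.2 fun x => (hA x).continuousAt
  have hb : ∀ᶠ x in 𝓝[<] t, |deriv A x| ≤ |deriv A t| + 1 := by
    apply Filter.Eventually.filter_mono nhdsWithin_le_nhds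
    have : ∀ᶠ x in 𝓝 t, |deriv A x| < |deriv A t| + 1 :=
      hc.abs.continuousAt.eventually_lt_const (by simp)
    exact this.mono fun x hx => hx.le
  obtain ⟨u, hu, hs⟩ := mem_nhdsLT_iff_exists_Ioo_subset.1 (h.and hb)
  have hL : LipschitzOnWith (Real.toNNReal (|deriv A t| + 1)) A (Ioo u t) := by
    apply Convex.lipschitzOnWith_of_nnnorm_deriv_le (𝕜 := ℝ)
    · intro x hx
      exact differentiableAt_of_deriv_ne_zero (hs hx).1
    · intro x hx
      rw [← NNReal.coe_le_coe, coe_nnnorm, Real.norm_eq_abs, Real.coe_toNNReal _ (by positivity)]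
      exact (hs hx).2
    · exact convex_Ioo _ _
  obtain ⟨F, hF, hFe⟩ := hL.extend_real
  have hmem : Ioo u t ∈ 𝓝[<] t := Ioo_mem_nhdsLT hu
  have hlim : Tendsto A (𝓝[<] t) (𝓝 (F t)) := by
    have : Tendsto F (𝓝[<] t) (𝓝 (F t)) := hF.continuous.continuousAt.tendsto.mono_left nhdsWithin_le_nhds
    exact this.congr' (by filter_upwards [hmem] with x hx using (hFe hx).symm)
  have hd := hasDerivWithinAt_Iic_of_tendsto_deriv (f := deriv A) (a := t) (e := t * F t) (s := Ioo u t)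
    (fun x _ => (hA x).differentiableAt.differentiableWithinAt) hc.continuousWithinAt hmem ?_
  · have h2 := (hA t).hasDerivWithinAt (s := Iic t)
    have := (uniqueDiffOn_Iic t t self_mem_Iic).eq_deriv (s := Iic t) (f := deriv A) hd h2
    have := mul_left_cancel₀ ht this
    rwa [this] at hlim
  · have : deriv (deriv A) = fun x => x * A x := funext fun x => (hA x).deriv
    rw [this]
    exact (tendsto_id.mono_left nhdsWithin_le_nhds).mul hlim

lemma airy_good {A : ℝ → ℝ} (hA : ∀ t, HasDerivAt (deriv A) (t * A t) t) (h0 : deriv A 0 ≠ 0) {t : ℝ}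
    (h : ¬ (A t = 0 ∧ deriv A t = 0)) : ∀ᶠ x in 𝓝 t, HasDerivAt A (deriv A x) x := by
  have hc : Continuous (deriv A) := continuous_iff_continuousAt.2 fun x => (hA x).continuousAt
  by_cases hd : deriv A t = 0
  · have ht : t ≠ 0 := by rintro rfl; exact h0 hd
    have hAt : A t ≠ 0 := fun h' => h ⟨h', hd⟩
    have hp : ∀ᶠ x in 𝓝[≠] t, deriv A x ≠ 0 := (hA t).eventually_ne (mul_ne_zero ht hAt)
    have hcA : ContinuousAt A t := by
      rw [continuousAt_iff_continuous_left'_right']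
      exact ⟨airy_left hA ht (hp.filter_mono (nhdsWithin_mono _ fun x hx => ne_of_lt hx)),
        airy_right hA ht (hp.filter_mono (nhdsWithin_mono _ fun x hx => ne_of_gt hx))⟩
    have hp' : ∀ᶠ x in 𝓝[≠] t, HasDerivAt A (deriv A x) x :=
      hp.mono fun x hx => (differentiableAt_of_deriv_ne_zero hx).hasDerivAt
    have hdt : HasDerivAt A (deriv A t) t := by
      have h1 := hasDerivWithinAt_Ici_of_tendsto_deriv (f := A) (a := t) (e := deriv A t)
        (s := {x | HasDerivAt A (deriv A x) x})
        (fun x hx => hx.differentiableAt.differentiableWithinAt) hcA.continuousWithinAt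
        (hp'.filter_mono (nhdsWithin_mono _ fun x hx => ne_of_gt hx))
        (hc.continuousAt.tendsto.mono_left nhdsWithin_le_nhds)
      have h2 := hasDerivWithinAt_Iic_of_tendsto_deriv (f := A) (a := t) (e := deriv A t)
        (s := {x | HasDerivAt A (deriv A x) x})
        (fun x hx => hx.differentiableAt.differentiableWithinAt) hcA.continuousWithinAt
        (hp'.filter_mono (nhdsWithin_mono _ fun x hx => ne_of_lt hx))
        (hc.continuousAt.tendsto.mono_left nhdsWithin_le_nhds)
      have := h2.union h1
      rwa [Iic_union_Ici, hasDerivWithinAt_univ] at this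
    rw [eventually_nhdsWithin_iff] at hp'
    filter_upwards [hp'] with x hx
    by_cases hxt : x = t
    · rw [hxt]; exact hdt
    · exact hx hxt
  · filter_upwards [hc.continuousAt.eventually_ne hd] with x hx
    exact (differentiableAt_of_deriv_ne_zero hx).hasDerivAt

lemma airy_eq {A β β1 : ℝ → ℝ} (hA : ∀ t, HasDerivAt (deriv A) (t * A t) t)
    (hβ : ∀ t, HasDerivAt β (β1 t) t) (hβ1 : ∀ t, HasDerivAt β1 (t * β t) t)
    (h0 : A 0 = β 0) (h1 : deriv A 0 = β1 0) (hne : deriv A 0 ≠ 0) : A = β := by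
  have hnz : ∀ t, ¬ (β t = 0 ∧ β1 t = 0) := by
    rintro t ⟨ht0, ht1⟩
    have hI : t ∈ Ioo (-(|t| + 1)) (|t| + 1) :=
      ⟨by linarith [neg_abs_le t], by linarith [le_abs_self t]⟩
    have hI0 : (0:ℝ) ∈ Ioo (-(|t| + 1)) (|t| + 1) :=
      ⟨by linarith [abs_nonneg t], by linarith [abs_nonneg t]⟩
    have := airy_unique hI β β1 (fun _ => 0) (fun _ => 0) (fun t _ => hβ t) (fun t _ => hβ1 t)
      (fun t _ => hasDerivAt_const _ _) (fun t _ => by simpa using hasDerivAt_const t (0:ℝ)) ht0 ht1 0 hI0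
    exact hne (h1.trans this.2)
  set D : ℝ → ℝ := fun t => deriv A t - β1 t with hD
  have hDd : ∀ t, HasDerivAt D (t * A t - t * β t) t := fun t => (hA t).sub (hβ1 t)
  have hDc : Continuous D := continuous_iff_continuousAt.2 fun x => (hDd x).continuousAt
  set P : Set ℝ := {t | D t = 0 ∧ t * A t - t * β t = 0} with hP
  have hcl : IsClosed P := by
    rw [← isOpen_compl_iff, isOpen_iff_mem_nhds]
    intro t ht
    by_cases h : D t = 0
    · have h2 : t * A t - t * β t ≠ 0 := fun h2 => ht ⟨h, h2⟩
      have := (hDd t).eventually_ne (c := 0) h2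
      rw [eventually_nhdsWithin_iff] at this
      filter_upwards [this] with x hx
      by_cases hxt : x = t
      · rw [hxt]; exact ht
      · exact fun hx' => hx hxt hx'.1
    · filter_upwards [hDc.continuousAt.eventually_ne h] with x hx
      exact fun hx' => hx hx'.1
  have hop : IsOpen P := by
    rw [isOpen_iff_mem_nhds]
    intro t ht
    have e0 : A t = β t := by
      by_cases h : t = 0
      · rw [h, h0]
      · have := ht.2
        rw [← mul_sub] at this
        rcases mul_eq_zero.1 this with h' | h'
        · exact absurd h' h
        · linarith
    have e1 : deriv A t = β1 t := sub_eq_zero.1 ht.1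
    have hg := airy_good hA hne (t := t) (by rw [e0, e1]; exact hnz t)
    obtain ⟨ε, hε, hs⟩ := Metric.eventually_nhds_iff_ball.1 hg
    rw [Real.ball_eq_Ioo] at hs
    have htI : t ∈ Ioo (t - ε) (t + ε) := ⟨by linarith, by linarith⟩
    have hu := airy_unique htI A (deriv A) β β1 hs (fun x _ => hA x) (fun x _ => hβ x)
      (fun x _ => hβ1 x) e0 e1
    filter_upwards [Ioo_mem_nhds htI.1 htI.2] with x hx
    have := hu x hx
    exact ⟨by simp [hD, this.2], by rw [this.1]; ring⟩
  have hPu : P = univ := by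
    apply IsClopen.eq_univ ⟨hcl, hop⟩
    exact ⟨0, by simp [hD, h1], by simp⟩
  funext t
  by_cases h : t = 0
  · rw [h, h0]
  · have := (hPu ▸ mem_univ t : t ∈ P).2
    rw [← mul_sub] at this
    rcases mul_eq_zero.1 this with h' | h'
    · exact absurd h' h
    · linarith

noncomputable def EK (p s : ℝ) (j : ℕ) (k : ℝ) : ℂ :=
  ((p : ℂ) + k * Complex.I) ^ j *
    Complex.exp (((p : ℂ) + k * Complex.I) ^ 3 / 3 - ((p : ℂ) + k * Complex.I) * s)

lemma EK_cont (p s : ℝ) (j : ℕ) : Continuous (EK p s j) := by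
  unfold EK; fun_prop

lemma EK_norm (p s : ℝ) (j : ℕ) (k : ℝ) :
    ‖EK p s j k‖ = ‖(p : ℂ) + k * Complex.I‖ ^ j * Real.exp (p ^ 3 / 3 - p * k ^ 2 - p * s) := by
  unfold EK
  rw [norm_mul, norm_pow, Complex.norm_exp]
  congr 2
  have : ((p : ℂ) + k * Complex.I) ^ 3 / 3 - ((p : ℂ) + k * Complex.I) * s
      = ((p ^ 3 / 3 - p * k ^ 2 - p * s : ℝ) : ℂ) + ((p ^ 2 * k - k ^ 3 / 3 - k * s : ℝ) : ℂ) * Complex.I := by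
    push_cast
    have h2 : Complex.I ^ 2 = -1 := Complex.I_sq
    have h3 : Complex.I ^ 3 = -Complex.I := by rw [pow_succ, h2]; ring
    ring_nf
    rw [h2, h3]; ring
  rw [this]
  simp only [Complex.add_re, Complex.ofReal_re, Complex.re_ofReal_mul, Complex.I_re, mul_zero, add_zero]

lemma z_norm_sq (p k : ℝ) : ‖(p : ℂ) + k * Complex.I‖ ^ 2 = p ^ 2 + k ^ 2 := by
  rw [← Complex.normSq_eq_norm_sq, Complex.normSq_add_mul_I]

lemma EK_bound (p s : ℝ) {j : ℕ} (hj : j ≤ 2) (k : ℝ) :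
    ‖EK p s j k‖ ≤ Real.exp (p ^ 3 / 3 - p * s) * ((1 + p ^ 2 + k ^ 2) * Real.exp (-p * k ^ 2)) := by
  rw [EK_norm]
  have h : ‖(p : ℂ) + k * Complex.I‖ ^ j ≤ 1 + p ^ 2 + k ^ 2 := by
    have h2 := z_norm_sq p k
    have h0 := norm_nonneg ((p : ℂ) + k * Complex.I)
    interval_cases j
    · nlinarith
    · nlinarith [sq_nonneg (‖(p : ℂ) + k * Complex.I‖ - 1)]
    · nlinarith
  calc _ ≤ (1 + p ^ 2 + k ^ 2) * Real.exp (p ^ 3 / 3 - p * k ^ 2 - p * s) := by gcongr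
    _ = _ := by
      rw [show p ^ 3 / 3 - p * k ^ 2 - p * s = (p ^ 3 / 3 - p * s) + (-p * k ^ 2) by ring, Real.exp_add]
      ring

lemma gauss_poly_int {p : ℝ} (hp : 0 < p) :
    Integrable fun k : ℝ => (1 + p ^ 2 + k ^ 2) * Real.exp (-p * k ^ 2) := by
  have h1 := integrable_exp_neg_mul_sq hp
  have h2 := integrable_rpow_mul_exp_neg_mul_sq hp (s := 2) (by norm_num)
  have h2' : Integrable fun k : ℝ => k ^ 2 * Real.exp (-p * k ^ 2) := by
    simpa using h2
  have := (h1.const_mul (1 + p ^ 2)).add h2'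
  refine this.congr (Eventually.of_forall fun k => ?_)
  simp only [Pi.add_apply]; ring

lemma EK_int {p : ℝ} (hp : 0 < p) (s : ℝ) {j : ℕ} (hj : j ≤ 2) : Integrable (EK p s j) :=
  ((gauss_poly_int hp).const_mul _).mono' (EK_cont p s j).aestronglyMeasurable
    (Eventually.of_forall fun k => EK_bound p s hj k)

lemma EK_hasDeriv {p : ℝ} (hp : 0 < p) (s : ℝ) {j : ℕ} (hj : j ≤ 1) :
    HasDerivAt (fun s => ∫ k, EK p s j k) (∫ k, - EK p s (j+1) k) s := by
  refine (hasDerivAt_integral_of_dominated_loc_of_deriv_le (F := fun s k => EK p s j k)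
    (F' := fun s k => - EK p s (j+1) k) (s := Ioo (s - 1) (s + 1))
    (bound := fun k => Real.exp (p ^ 3 / 3 - p * (s - 1)) * ((1 + p ^ 2 + k ^ 2) * Real.exp (-p * k ^ 2)))
    (Ioo_mem_nhds (by linarith) (by linarith)) ?_ ?_ ?_ ?_ ?_ ?_).2
  · exact Eventually.of_forall fun s => (EK_cont p s j).aestronglyMeasurable
  · exact EK_int hp s (by omega)
  · exact (EK_cont p s (j+1)).neg.aestronglyMeasurable
  · refine Eventually.of_forall fun k x hx => ?_
    rw [norm_neg]
    refine (EK_bound p x (by omega) k).trans ?_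
    gcongr
    exact hx.1.le
  · exact (gauss_poly_int hp).const_mul _
  · refine Eventually.of_forall fun k x hx => ?_
    unfold EK
    have h1 : HasDerivAt (fun x : ℝ => (x : ℂ)) 1 x := Complex.ofRealCLM.hasDerivAt
    have := ((((h1.const_mul ((p : ℂ) + k * Complex.I))).const_sub
      (((p : ℂ) + k * Complex.I) ^ 3 / 3)).cexp).const_mul (((p : ℂ) + k * Complex.I) ^ j)
    refine this.congr_deriv ?_
    ring

lemma EK_ode {p : ℝ} (hp : 0 < p) (s : ℝ) :
    ∫ k, EK p s 2 k = s * ∫ k, EK p s 0 k := by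
  have hd : ∀ k, HasDerivAt (EK p s 0) (Complex.I * (EK p s 2 k - s * EK p s 0 k)) k := by
    intro k
    unfold EK
    have h1 : HasDerivAt (fun x : ℝ => (x : ℂ)) 1 k := Complex.ofRealCLM.hasDerivAt
    have hz : HasDerivAt (fun x : ℝ => (p : ℂ) + x * Complex.I) (1 * Complex.I) k :=
      (h1.mul_const Complex.I).const_add _
    have := (((hz.pow 3).div_const 3).sub (hz.mul_const (s : ℂ))).cexp
    simp only [pow_zero, one_mul]
    refine this.congr_deriv ?_
    simp only [Pi.sub_apply, Pi.pow_apply]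
    push_cast
    ring
  have hi : Integrable fun k => Complex.I * (EK p s 2 k - s * EK p s 0 k) :=
    ((EK_int hp s le_rfl).sub ((EK_int hp s (by norm_num)).const_mul _)).const_mul _
  have := integral_eq_zero_of_hasDerivAt_of_integrable hd hi (EK_int hp s (by norm_num))
  rw [integral_const_mul, integral_sub (EK_int hp s le_rfl) ((EK_int hp s (by norm_num)).const_mul _),
    integral_const_mul] at this
  rcases mul_eq_zero.1 this with h | h
  · exact absurd h Complex.I_ne_zero
  · exact sub_eq_zero.1 h

lemma EK_neg (p s : ℝ) (j : ℕ) (k : ℝ) : EK p s j (-k) = (starRingEnd ℂ) (EK p s j k) := by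
  unfold EK
  rw [map_mul, map_pow, ← Complex.exp_conj]
  simp [map_ofNat]

lemma EK_real (p s : ℝ) (j : ℕ) : ∫ k, EK p s j k = ((∫ k, EK p s j k).re : ℂ) := by
  symm
  rw [← Complex.conj_eq_iff_re, ← integral_conj, ← integral_neg_eq_self]
  congr 1; funext k
  rw [EK_neg, Complex.conj_conj]

lemma fj_path (G : ℂ → ℂ) (f : ℂ → ℂ) (hf : Continuous f) (hG : ∀ z, HasDerivAt G (f z) z) (a c : ℂ) (u v : ℝ) :
    ∫ t in u..v, c * f (a + t * c) = G (a + v * c) - G (a + u * c) := by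
  apply intervalIntegral.integral_eq_sub_of_hasDerivAt (f := fun t : ℝ => G (a + t * c))
  · intro t _
    have h1 : HasDerivAt (fun x : ℝ => (x : ℂ)) 1 t := Complex.ofRealCLM.hasDerivAt
    have hz : HasDerivAt (fun x : ℝ => a + x * c) (1 * c) t := (h1.mul_const c).const_add _
    have := (hG (a + t * c)).comp t hz
    refine this.congr_deriv ?_
    ring
  · apply Continuous.intervalIntegrable; fun_prop

lemma airy_init {p : ℝ} (hp : 0 < p) {j : ℕ} (hj : j ≤ 1) :
    (∫ k, EK p 0 j k).re = 2 * ((Real.sqrt 3 / 2) * ∫ r in Ioi (0:ℝ), r ^ j * Real.exp (-(r ^ 3) / 3)) := by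
  set f : ℂ → ℂ := fun z => z ^ j * Complex.exp (z ^ 3 / 3) with hf
  have hfd : Differentiable ℂ f := by rw [hf]; fun_prop
  have hfc : Continuous f := hfd.continuous
  obtain ⟨G, hG'⟩ := hfd.isExactOn_univ
  have hG : ∀ z, HasDerivAt G (f z) z := fun z => hG' z (mem_univ _)
  set ω : ℂ := (1 / 2 : ℝ) + (Real.sqrt 3 / 2 : ℝ) * Complex.I with hω
  have s3 : ((Real.sqrt 3 : ℝ) : ℂ) ^ 2 = 3 := by
    norm_cast; exact Real.sq_sqrt (by norm_num)
  have hω2 : ω ^ 2 = ((-1 / 2 : ℝ) : ℂ) + (Real.sqrt 3 / 2 : ℝ) * Complex.I := by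
    rw [hω]; push_cast
    linear_combination (1/4 : ℂ) * (Complex.I ^ 2) * s3 + (3/4 : ℂ) * Complex.I_sq
  have hω3 : ω ^ 3 = -1 := by
    rw [pow_succ, hω2, hω]; push_cast
    linear_combination (1/4 : ℂ) * (Complex.I ^ 2) * s3 + (3/4 : ℂ) * Complex.I_sq
  have hωim : (ω ^ (j + 1)).im = Real.sqrt 3 / 2 := by
    interval_cases j
    · simp [hω]
    · rw [show (1 + 1 : ℕ) = 2 from rfl, hω2]; simp
  have hEK : ∀ k : ℝ, EK p 0 j k = f (p + k * Complex.I) := by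
    intro k; simp [EK, hf]
  -- three path integrals
  have H1 : ∀ R : ℝ, (∫ k in (0:ℝ)..R, (EK p 0 j k).re) = (G (p + R * Complex.I) - G p).im := by
    intro R
    have := fj_path G f hfc hG p Complex.I 0 R
    simp only [Complex.ofReal_zero, zero_mul, add_zero] at this
    rw [← this, intervalIntegral.integral_const_mul, Complex.I_mul_im]
    have h2 := Complex.reCLM.intervalIntegral_comp_comm (μ := volume)
      ((hfc.comp (by fun_prop : Continuous fun t : ℝ => (p : ℂ) + t * Complex.I)).intervalIntegrable 0 R)
    simp only [Complex.reCLM_apply, Function.comp_def] at h2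
    rw [← h2]
    simp only [hEK]
  have H2 : ∀ R : ℝ, (Real.sqrt 3 / 2) * (∫ r in (0:ℝ)..R, r ^ j * Real.exp (-(r ^ 3) / 3)) = (G (R * ω) - G 0).im := by
    intro R
    have := fj_path G f hfc hG 0 ω 0 R
    simp only [Complex.ofReal_zero, zero_mul, add_zero, zero_add] at this
    rw [← this, ← hωim, ← Complex.im_mul_ofReal, ← intervalIntegral.integral_ofReal,
      ← intervalIntegral.integral_const_mul]
    congr 2; funext r
    simp only [hf]
    rw [mul_pow (r : ℂ) ω 3, hω3]
    push_cast
    rw [show (r:ℂ) ^ 3 * -1 = -((r:ℂ)^3) by ring]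
    ring
  have H3 : (G p - G 0).im = 0 := by
    have := fj_path G f hfc hG 0 1 0 p
    simp only [Complex.ofReal_zero, add_zero, zero_add, mul_one, one_mul] at this
    rw [← this]
    have h : ∀ t : ℝ, f t = ((t ^ j * Real.exp (t ^ 3 / 3) : ℝ) : ℂ) := by
      intro t; simp [hf]
    simp only [h]
    rw [intervalIntegral.integral_ofReal, Complex.ofReal_im]
  have H4 : ∀ T : ℝ, p ≤ T → 1 ≤ T →
      ‖G ((2 * T : ℝ) * ω) - G (p + (Real.sqrt 3 * T : ℝ) * Complex.I)‖ ≤ (2 * T) * Real.exp (-p * T ^ 2) * T := by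
    intro T hT hT1
    have := fj_path G f hfc hG ((Real.sqrt 3 * T : ℝ) * Complex.I) 1 p T
    have e1 : ((2 * T : ℝ) : ℂ) * ω = (Real.sqrt 3 * T : ℝ) * Complex.I + T * 1 := by
      rw [hω]; push_cast; ring
    rw [e1, add_comm (p : ℂ), ← mul_one (p : ℂ), ← this]
    have hb := intervalIntegral.norm_integral_le_of_norm_le_const (a := p) (b := T)
      (C := (2 * T) * Real.exp (-p * T ^ 2))
      (f := fun t : ℝ => 1 * f ((Real.sqrt 3 * T : ℝ) * Complex.I + t * 1)) ?_
    · refine hb.trans ?_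
      gcongr
      rw [abs_of_nonneg (by linarith)]; linarith
    · intro x hx
      rw [uIoc_of_le hT] at hx
      have e2 : (1 : ℂ) * f ((Real.sqrt 3 * T : ℝ) * Complex.I + x * 1) = EK x 0 j (Real.sqrt 3 * T) := by
        simp [EK, hf, add_comm]
      rw [e2, EK_norm]
      have s3' : Real.sqrt 3 ^ 2 = 3 := Real.sq_sqrt (by norm_num)
      have hx0 : 0 < x := hp.trans hx.1
      have hn : ‖(x : ℂ) + (Real.sqrt 3 * T : ℝ) * Complex.I‖ ≤ 2 * T := by
        apply le_of_sq_le_sq _ (by linarith)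
        rw [z_norm_sq, mul_pow, s3']
        nlinarith [hx.2]
      have hn' : ‖(x : ℂ) + (Real.sqrt 3 * T : ℝ) * Complex.I‖ ^ j ≤ 2 * T := by
        interval_cases j
        · simp; linarith
        · simpa using hn
      apply mul_le_mul hn' _ (Real.exp_nonneg _) (by linarith)
      apply Real.exp_le_exp.2
      rw [mul_pow, s3']
      have h1 : x ^ 2 ≤ T ^ 2 := by nlinarith [hx.2]
      have h2 : p * T ^ 2 ≤ x * T ^ 2 := by nlinarith [hx.1, sq_nonneg T]
      have h3 : x * x ^ 2 ≤ x * T ^ 2 := by nlinarith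
      nlinarith [mul_nonneg hx0.le (sq_nonneg T)]
  -- limits
  have hEi : Integrable (fun k => (EK p 0 j k).re) := (EK_int hp 0 (by omega)).re
  have hT1 : Tendsto (fun T : ℝ => Real.sqrt 3 * T) atTop atTop :=
    tendsto_id.const_mul_atTop (by positivity)
  have hT2 : Tendsto (fun T : ℝ => 2 * T) atTop atTop := tendsto_id.const_mul_atTop (by positivity)
  have hJi : IntegrableOn (fun r : ℝ => r ^ j * Real.exp (-(r ^ 3) / 3)) (Ioi 0) := by
    have := integrableOn_rpow_mul_exp_neg_mul_rpow (p := 3) (s := j) (b := 1/3)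
      (by have : (0:ℝ) ≤ j := by positivity
          linarith) (by norm_num) (by norm_num)
    refine this.congr_fun (fun r hr => ?_) measurableSet_Ioi
    simp only [Real.rpow_natCast]
    congr 2
    rw [show (3:ℝ) = ((3:ℕ):ℝ) by norm_num, Real.rpow_natCast]
    push_cast; ring
  have L1 := (intervalIntegral_tendsto_integral_Ioi 0 hEi.integrableOn tendsto_id).comp hT1
  have L2 := ((intervalIntegral_tendsto_integral_Ioi 0 hJi tendsto_id).comp hT2).const_mul (Real.sqrt 3 / 2)
  have L3 : Tendsto (fun T : ℝ => (2 * T) * Real.exp (-p * T ^ 2) * T) atTop (𝓝 0) := by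
    have h := (tendsto_rpow_mul_exp_neg_mul_atTop_nhds_zero 1 p hp).comp (tendsto_pow_atTop (α := ℝ) (n := 2) (by norm_num))
    have := h.const_mul 2
    rw [mul_zero] at this
    refine this.congr fun T => ?_
    simp only [Function.comp, Real.rpow_one]; ring
  have L4 := L2.sub L1
  have L5 := squeeze_zero_norm' (f := fun T => (Real.sqrt 3 / 2) * (∫ r in (0:ℝ)..(2 * T), r ^ j * Real.exp (-(r ^ 3) / 3)) - ∫ k in (0:ℝ)..(Real.sqrt 3 * T), (EK p 0 j k).re) ?_ L3
  · have := tendsto_nhds_unique L4 L5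
    have hh := sub_eq_zero.1 this
    rw [hh]
    have hre : (∫ k, EK p 0 j k).re = ∫ k, (EK p 0 j k).re := by
      have := Complex.reCLM.integral_comp_comm (EK_int hp 0 (by omega : j ≤ 2))
      simpa using this.symm
    rw [hre]
    have habs : ∫ k, (EK p 0 j k).re = ∫ k, (EK p 0 j |k|).re := by
      congr 1
      funext k
      rcases abs_choice k with h | h
      · rw [h]
      · rw [h, EK_neg, Complex.conj_re]
    rw [habs, integral_comp_abs (f := fun k => (EK p 0 j k).re)]
  · filter_upwards [eventually_ge_atTop p, eventually_ge_atTop 1] with T h1 h2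
    refine le_trans ?_ (H4 T h1 h2)
    rw [H1, H2]
    have : (G ((2 * T : ℝ) * ω) - G 0).im - (G (p + (Real.sqrt 3 * T : ℝ) * Complex.I) - G p).im
        = (G ((2 * T : ℝ) * ω) - G (p + (Real.sqrt 3 * T : ℝ) * Complex.I)).im := by
      simp only [Complex.sub_im] at H3 ⊢
      linarith
    rw [this]
    exact Complex.abs_im_le_norm _

open scoped FourierTransform in
lemma plancherel_aux (φ : ℝ → ℂ) (hc : Continuous φ) (hi : Integrable φ) (hF : Integrable (𝓕 φ)) :
    ∫ ξ, ‖𝓕 φ ξ‖ ^ 2 = ∫ x, ‖φ x‖ ^ 2 := by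
  have h : ∫ ξ, innerSL ℂ (𝓕 φ ξ) (𝓕 φ ξ) = ∫ x, innerSL ℂ (φ x) (𝓕⁻ (𝓕 φ) x) := by
    have := VectorFourier.integral_sesq_fourierIntegral_eq_neg_flip (innerSL ℂ (E := ℂ))
      (L := innerₗ ℝ) (μ := volume) (ν := volume) Real.continuous_fourierChar continuous_inner hi hF
    simpa [Real.fourierInv_eq, VectorFourier.fourierIntegral, Real.fourier_eq] using! this
  rw [hc.fourierInv_fourier_eq hi hF] at h
  apply Complex.ofReal_injective
  rw [← integral_complex_ofReal, ← integral_complex_ofReal]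
  simpa [inner_self_eq_norm_sq_to_K] using h

lemma Gamma_vals :
    1 / (2 * Real.pi) * (2 * ((Real.sqrt 3 / 2) * ∫ r in Ioi (0:ℝ), r ^ 0 * Real.exp (-(r ^ 3) / 3)))
      = 1 / ((3 : ℝ) ^ ((2 : ℝ) / 3) * Real.Gamma (2 / 3)) ∧
    1 / (2 * Real.pi) * (2 * ((Real.sqrt 3 / 2) * ∫ r in Ioi (0:ℝ), r ^ 1 * Real.exp (-(r ^ 3) / 3)))
      = 1 / ((3 : ℝ) ^ ((1 : ℝ) / 3) * Real.Gamma (1 / 3)) := by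
  have hI : ∀ j : ℕ, ∫ r in Ioi (0:ℝ), r ^ j * Real.exp (-(r ^ 3) / 3)
      = (1/3 : ℝ) ^ (-((j:ℝ) + 1) / 3) * (1 / 3) * Real.Gamma (((j:ℝ) + 1) / 3) := by
    intro j
    rw [← integral_rpow_mul_exp_neg_mul_rpow (p := 3) (q := j) (b := 1/3) (by norm_num)
      (by have : (0:ℝ) ≤ j := by positivity
          linarith) (by norm_num)]
    refine setIntegral_congr_fun measurableSet_Ioi (fun r hr => ?_)
    simp only [Real.rpow_natCast]
    congr 2
    rw [show (3:ℝ) = ((3:ℕ):ℝ) by norm_num, Real.rpow_natCast]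
    push_cast; ring
  have hG := Real.Gamma_mul_Gamma_one_sub (1/3)
  rw [show (1:ℝ) - 1/3 = 2/3 by norm_num, show Real.pi * (1/3) = Real.pi / 3 by ring, Real.sin_pi_div_three] at hG
  have g1 : 0 < Real.Gamma (1/3) := Real.Gamma_pos_of_pos (by norm_num)
  have g2 : 0 < Real.Gamma (2/3) := Real.Gamma_pos_of_pos (by norm_num)
  have hpi := Real.pi_pos
  have hs : 0 < Real.sqrt 3 := by positivity
  have hGm : Real.Gamma (1/3) * Real.Gamma (2/3) * Real.sqrt 3 = 2 * Real.pi := by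
    rw [hG]; field_simp
  have h3 : ∀ a : ℝ, (1/3 : ℝ) ^ (-a) = 3 ^ a := by
    intro a
    rw [one_div, Real.inv_rpow (by norm_num), Real.rpow_neg (by norm_num), inv_inv]
  have hm : (3:ℝ) ^ ((1:ℝ)/3) * 3 ^ ((2:ℝ)/3) = 3 := by
    rw [← Real.rpow_add (by norm_num)]; norm_num
  have p1 : 0 < (3:ℝ) ^ ((1:ℝ)/3) := by positivity
  have p2 : 0 < (3:ℝ) ^ ((2:ℝ)/3) := by positivity
  rw [hI 0, hI 1]
  norm_num only [Nat.cast_zero, Nat.cast_one, zero_add, one_add_one_eq_two]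
  rw [h3, h3]
  set a := (3:ℝ) ^ ((1:ℝ)/3)
  set b := (3:ℝ) ^ ((2:ℝ)/3)
  set x := Real.Gamma (1/3)
  set y := Real.Gamma (2/3)
  constructor
  · rw [eq_div_iff (by positivity)]
    field_simp
    linear_combination (x * y * √3) * hm + 3 * hGm
  · rw [eq_div_iff (by positivity)]
    field_simp
    linear_combination (x * y * √3) * hm + 3 * hGm

lemma airy_rep {Ai : ℝ → ℝ}
    (hAiODE : ∀ t, HasDerivAt (deriv Ai) (t * Ai t) t)
    (hAi0 : Ai 0 = 1 / ((3 : ℝ) ^ ((2 : ℝ) / 3) * Real.Gamma (2 / 3)))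
    (hAi0' : deriv Ai 0 = -(1 / ((3 : ℝ) ^ ((1 : ℝ) / 3) * Real.Gamma (1 / 3)))) {p : ℝ} (hp : 0 < p) (s : ℝ) :
    (2 * Real.pi * Ai s : ℂ) = ∫ k, EK p s 0 k := by
  have hre : ∀ (j : ℕ) (_ : j ≤ 1) (s : ℝ), HasDerivAt (fun s => (∫ k, EK p s j k).re) (-(∫ k, EK p s (j+1) k).re) s := by
    intro j hj s
    have := Complex.reCLM.hasFDerivAt.comp_hasDerivAt s (EK_hasDeriv hp s hj)
    refine this.congr_deriv ?_
    rw [integral_neg]; simp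
  have key := airy_eq (A := Ai) (β := fun s => 1 / (2 * Real.pi) * (∫ k, EK p s 0 k).re)
    (β1 := fun s => 1 / (2 * Real.pi) * -(∫ k, EK p s 1 k).re) hAiODE
    (fun t => (hre 0 (by norm_num) t).const_mul _) (fun t => ?_) ?_ ?_ ?_
  · rw [key, EK_real]
    push_cast
    have : (Real.pi : ℂ) ≠ 0 := by exact_mod_cast Real.pi_ne_zero
    field_simp
  · refine ((hre 1 le_rfl t).neg.const_mul _).congr_deriv ?_
    rw [EK_ode hp t, Complex.re_ofReal_mul]; ring
  · rw [airy_init hp (by norm_num), Gamma_vals.1, hAi0]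
  · rw [airy_init hp (by norm_num), mul_neg, Gamma_vals.2, hAi0']
  · rw [hAi0']
    have g1 : 0 < Real.Gamma (1/3) := Real.Gamma_pos_of_pos (by norm_num)
    exact neg_ne_zero.2 (by positivity)

lemma airy_bd {Ai : ℝ → ℝ} (h : ∀ p, 0 < p → ∀ s : ℝ, (2 * Real.pi * Ai s : ℂ) = ∫ k, EK p s 0 k)
    {q : ℝ} (hq : 0 < q) : ∃ C : ℝ, 0 ≤ C ∧ ∀ s, |Ai s| ≤ C * Real.exp (-q * s) := by
  refine ⟨1 / (2 * Real.pi) * ∫ k, ‖EK q 0 0 k‖, by positivity, fun s => ?_⟩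
  have h1 : ‖(2 * Real.pi * Ai s : ℂ)‖ ≤ ∫ k, ‖EK q s 0 k‖ := by
    rw [h q hq s]; exact norm_integral_le_integral_norm _
  have h2 : ∀ k, ‖EK q s 0 k‖ = ‖EK q 0 0 k‖ * Real.exp (-q * s) := by
    intro k
    rw [EK_norm, EK_norm, mul_assoc, ← Real.exp_add]
    congr 2; ring
  simp only [h2] at h1
  rw [integral_mul_const] at h1
  have h3 : ‖(2 * Real.pi * Ai s : ℂ)‖ = 2 * Real.pi * |Ai s| := by
    simp [abs_of_pos Real.pi_pos]
  rw [h3] at h1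
  have hpi := Real.pi_pos
  rw [mul_assoc, one_div, ← div_eq_inv_mul, le_div_iff₀ (by positivity)]
  linarith

lemma exp_abs_int {c : ℝ} (hc : 0 < c) : Integrable fun s : ℝ => Real.exp (-c * |s|) := by
  rw [← integrableOn_univ, ← Iic_union_Ioi (a := (0:ℝ))]
  apply IntegrableOn.union
  · refine (integrableOn_exp_mul_Iic hc 0).congr_fun (fun s hs => ?_) measurableSet_Iic
    simp only
    rw [abs_of_nonpos hs]; congr 1; ring
  · refine (exp_neg_integrableOn_Ioi 0 hc).congr_fun (fun s hs => ?_) measurableSet_Ioi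
    simp only
    rw [abs_of_pos hs]

open scoped FourierTransform in
lemma airy_J {Ai : ℝ → ℝ} (h : ∀ p, 0 < p → ∀ s : ℝ, (2 * Real.pi * Ai s : ℂ) = ∫ k, EK p s 0 k)
    (hm : Continuous Ai) {p : ℝ} (hp : 0 < p) :
    ∫ s : ℝ, Real.exp (2 * p * s) * (Ai s) ^ 2
      = 1 / (2 * Real.pi) * (Real.exp (2 * p ^ 3 / 3) * Real.sqrt (Real.pi / (2 * p))) := by
  have hpi := Real.pi_pos
  have hF : 𝓕 (EK p 0 0) = fun ξ : ℝ => ((2 * Real.pi * (Real.exp (p * (2 * Real.pi * ξ)) * Ai (2 * Real.pi * ξ)) : ℝ) : ℂ) := by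
    funext ξ
    have := h p hp (2 * Real.pi * ξ)
    push_cast at this ⊢
    rw [show ∀ a b c : ℂ, a * (b * c) = b * (a * c) from fun a b c => by ring, this, Real.fourier_eq',
      ← integral_const_mul]
    congr 1; funext k
    simp only [EK, pow_zero, one_mul, smul_eq_mul]
    rw [← Complex.exp_add, ← Complex.exp_add]
    congr 1
    simp
    ring
  obtain ⟨C1, hC1, h1⟩ := airy_bd h (q := p / 2) (by positivity)
  obtain ⟨C2, hC2, h2⟩ := airy_bd h (q := 2 * p) (by positivity)
  have hint : Integrable (fun s => Real.exp (p * s) * Ai s) := by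
    have hg : Integrable fun s : ℝ => (C1 + C2) * Real.exp (-(p / 2) * |s|) := by
      apply Integrable.const_mul
      exact exp_abs_int (by positivity)
    refine hg.mono' (by fun_prop) (Eventually.of_forall fun s => ?_)
    rw [norm_mul, Real.norm_eq_abs, Real.norm_eq_abs, Real.abs_exp]
    rcases le_total 0 s with hs | hs
    · rw [abs_of_nonneg hs]
      calc _ ≤ Real.exp (p * s) * (C2 * Real.exp (-(2 * p) * s)) := by gcongr; exact h2 s
        _ = C2 * Real.exp (-p * s) := by
          rw [mul_left_comm, ← Real.exp_add]; congr 2; ring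
        _ ≤ _ := by gcongr <;> nlinarith
    · rw [abs_of_nonpos hs]
      calc _ ≤ Real.exp (p * s) * (C1 * Real.exp (-(p / 2) * s)) := by gcongr; exact h1 s
        _ = C1 * Real.exp (-(p/2) * -s) := by
          rw [mul_left_comm, ← Real.exp_add]; congr 2; ring
        _ ≤ _ := by gcongr; linarith
  have hFi : Integrable (𝓕 (EK p 0 0)) := by
    rw [hF]
    apply Integrable.ofReal
    apply Integrable.const_mul
    exact hint.comp_mul_left' (g := fun s => Real.exp (p * s) * Ai s) (by positivity)
  have hP := plancherel_aux _ (EK_cont p 0 0) (EK_int hp 0 (by norm_num)) hFi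
  have hR : ∫ x, ‖EK p 0 0 x‖ ^ 2 = Real.exp (2 * p ^ 3 / 3) * Real.sqrt (Real.pi / (2 * p)) := by
    rw [← integral_gaussian, ← integral_const_mul]
    congr 1; funext k
    rw [EK_norm, pow_zero, one_mul, ← Real.exp_nat_mul, ← Real.exp_add]
    congr 1; push_cast; ring
  have hL : ∫ x, ‖𝓕 (EK p 0 0) x‖ ^ 2 = (2 * Real.pi) * ∫ s : ℝ, Real.exp (2 * p * s) * (Ai s) ^ 2 := by
    have e : ∀ ξ, ‖𝓕 (EK p 0 0) ξ‖ ^ 2 = (2 * Real.pi) ^ 2 *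
        (fun s => Real.exp (2 * p * s) * (Ai s) ^ 2) (2 * Real.pi * ξ) := by
      intro ξ
      rw [hF]
      simp only [Complex.norm_real, Real.norm_eq_abs, sq_abs]
      rw [mul_pow (2 * Real.pi), mul_pow (Real.exp _), ← Real.exp_nat_mul]
      congr 3; push_cast; ring
    simp only [e]
    rw [integral_const_mul, Measure.integral_comp_mul_left (fun s => Real.exp (2 * p * s) * (Ai s) ^ 2)]
    rw [abs_of_pos (by positivity), smul_eq_mul]
    field_simp
  rw [hL, hR] at hP
  rw [← hP]; field_simp

/-- With `J(p) = ∫ e^{2ps} Ai(s)² ds`, one has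
`lim_{p→0⁺} p^{1/2} J(p) = 1/(2^{3/2}√π)`. -/
theorem stmt_11 (Ai : ℝ → ℝ)
    (hAiODE : ∀ t, HasDerivAt (deriv Ai) (t * Ai t) t)
    (hAi0 : Ai 0 = 1 / ((3 : ℝ) ^ ((2 : ℝ) / 3) * Real.Gamma (2 / 3)))
    (hAi0' : deriv Ai 0 = -(1 / ((3 : ℝ) ^ ((1 : ℝ) / 3) * Real.Gamma (1 / 3)))) :
    Filter.Tendsto
      (fun p : ℝ => Real.sqrt p * ∫ s : ℝ, Real.exp (2 * p * s) * (Ai s) ^ 2)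
      (nhdsWithin 0 (Set.Ioi 0))
      (nhds (1 / ((2 : ℝ) ^ ((3 : ℝ) / 2) * Real.sqrt Real.pi))) := by
  have hpi := Real.pi_pos
  have h : ∀ p, 0 < p → ∀ s : ℝ, (2 * Real.pi * Ai s : ℂ) = ∫ k, EK p s 0 k :=
    fun p hp s => airy_rep hAiODE hAi0 hAi0' hp s
  have hm : Continuous Ai := by
    have hc : Continuous fun s : ℝ => ∫ k, EK 1 s 0 k := continuous_iff_continuousAt.2 fun s =>
      (EK_hasDeriv one_pos s (j := 0) (by norm_num)).continuousAt
    have : Ai = fun s => 1 / (2 * Real.pi) * (∫ k, EK 1 s 0 k).re := by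
      funext s
      rw [← h 1 one_pos s]
      have : (2 * Real.pi * Ai s : ℂ) = ((2 * Real.pi * Ai s : ℝ) : ℂ) := by push_cast; rfl
      rw [this, Complex.ofReal_re]; field_simp
    rw [this]
    exact continuous_const.mul (Complex.continuous_re.comp hc)
  have h2 : (2:ℝ) ^ ((3:ℝ)/2) = 2 * Real.sqrt 2 := by
    rw [show (3:ℝ)/2 = 1 + 1/2 by norm_num, Real.rpow_add (by norm_num), Real.rpow_one, Real.sqrt_eq_rpow]
  have hlim : Tendsto (fun p : ℝ => Real.exp (2 * p ^ 3 / 3) * (1 / (2 * Real.sqrt 2 * Real.sqrt Real.pi)))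
      (𝓝[>] 0) (𝓝 (1 / ((2 : ℝ) ^ ((3 : ℝ) / 2) * Real.sqrt Real.pi))) := by
    have : Continuous (fun p : ℝ => Real.exp (2 * p ^ 3 / 3) * (1 / (2 * Real.sqrt 2 * Real.sqrt Real.pi))) := by
      fun_prop
    have := (this.tendsto 0).mono_left (nhdsWithin_le_nhds (s := Ioi 0))
    rw [h2]
    simpa using this
  refine hlim.congr' ?_
  filter_upwards [self_mem_nhdsWithin] with p hp
  have hp : 0 < p := hp
  rw [airy_J h hm hp, Real.sqrt_div hpi.le, Real.sqrt_mul (by norm_num)]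
  have e1 : Real.sqrt Real.pi ^ 2 = Real.pi := Real.sq_sqrt hpi.le
  have e2 : 0 < Real.sqrt p := Real.sqrt_pos.2 hp
  have e3 : 0 < Real.sqrt Real.pi := Real.sqrt_pos.2 hpi
  field_simp
  rw [e1]
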